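/- Let C = C₁ + ⋯ + C_k be a conic-line arrangement with simple nodes. Two topological double covers φ′: C′ → C and φ″: C″ → C are homeomorphic over C if and only if their gluing data κ_{φ′} and κ_{φ″} are equivalent. Consequently, the map Ψ from the set of homeomorphism classes over C of topological double covers of C to the set of equivalence classes of gluing data on C, given by [φ] ↦ [κ_φ], is a bijection. -/

import Mathlib

/-!
Basic setup: the complex projective plane, plane curves, conic-line arrangements
with simple nodes, topological double covers and gluing data.
-/

open MvPolynomial

noncomputable section

/-- The complex projective plane `ℙ²(ℂ)`. -/
abbrev P2 : Type := Projectivization ℂ (Fin 3 → ℂ)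

/-- The quotient topology on `ℙ²(ℂ)` (quotient of `ℂ³ ∖ {0}`). -/
instance : TopologicalSpace P2 :=
  (inferInstance : TopologicalSpace (Quotient (projectivizationSetoid ℂ (Fin 3 → ℂ))))

/-- Evaluation of a polynomial at (the chosen representative of) a point of `ℙ²`. -/
def pev (g : MvPolynomial (Fin 3) ℂ) (x : P2) : ℂ :=
  MvPolynomial.eval x.rep g

/-- The zero locus in `ℙ²(ℂ)` of a (homogeneous) polynomial. -/
def zeroLocus (g : MvPolynomial (Fin 3) ℂ) : Set P2 :=
  {x : P2 | pev g x = 0}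

/-- A conic-line arrangement with simple nodes `C = C₁ + ⋯ + C_k` in `ℙ²(ℂ)`:
each component is (the zero locus of) a nonzero homogeneous polynomial of degree 1 (a line)
or 2, smooth (so a degree 2 component is a smooth conic), the components are pairwise
distinct, and all intersection points are ordinary double points: every singular point lies
on exactly two components, whose tangent directions there are distinct (transversal
intersection). -/
structure ConicLineArrangement (k : ℕ) where
  f : Fin k → MvPolynomial (Fin 3) ℂ
  deg : Fin k → ℕ
  deg_one_or_two : ∀ i, deg i = 1 ∨ deg i = 2
  homog : ∀ i, (f i).IsHomogeneous (deg i)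
  ne_zero : ∀ i, f i ≠ 0
  smooth : ∀ i, ∀ x : P2, pev (f i) x = 0 → ∃ m : Fin 3, pev (pderiv m (f i)) x ≠ 0
  distinct : ∀ i j, i ≠ j → zeroLocus (f i) ≠ zeroLocus (f j)
  nodes : ∀ i j, i ≠ j → ∀ x ∈ zeroLocus (f i) ∩ zeroLocus (f j),
    (∀ l, x ∈ zeroLocus (f l) → l = i ∨ l = j) ∧
    ¬ ∃ c : ℂ, ∀ m : Fin 3, pev (pderiv m (f j)) x = c * pev (pderiv m (f i)) x

namespace ConicLineArrangement

variable {k : ℕ}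

/-- The `i`-th irreducible component `C_i` of the arrangement, as a subset of `ℙ²`. -/
def curve (A : ConicLineArrangement k) (i : Fin k) : Set P2 := zeroLocus (A.f i)

/-- The support of the arrangement: the curve `C = C₁ + ⋯ + C_k` as a subset of `ℙ²`. -/
def plane (A : ConicLineArrangement k) : Set P2 := ⋃ i, A.curve i

/-- The set `Sing(C)` of singular points of the arrangement, i.e. its nodes:
the points lying on (at least) two distinct components. -/
def sing (A : ConicLineArrangement k) : Set P2 :=
  {x : P2 | ∃ i j, i ≠ j ∧ x ∈ A.curve i ∧ x ∈ A.curve j}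

end ConicLineArrangement

/-- A topological double cover: a covering map all of whose fibers have exactly
two points. -/
def IsDoubleCover {E X : Type*} [TopologicalSpace E] [TopologicalSpace X] (φ : E → X) : Prop :=
  IsCoveringMap φ ∧ ∀ x : X, Nat.card (φ ⁻¹' {x}) = 2

/-- `SplitsOver φ S x`: the subset `S` of the total space of `φ : C' → C` is mapped
homeomorphically onto the subset `x` of `C`, i.e. `φ` restricted to `S` is a topological
embedding with image (the subtype corresponding to) `x`. -/
def SplitsOver {E X : Type*} [TopologicalSpace E] [TopologicalSpace X]
    (φ : E → X) (S : Set E) (x : Set X) : Prop :=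
  Topology.IsEmbedding (fun y : S => φ (y : E)) ∧ Set.range (fun y : S => φ (y : E)) = x


section GluingData

variable {k : ℕ}

/-- A gluing data of order two on the arrangement `C`: a map `Sing(C) → {+,-}`
(`true` stands for `+`, `false` for `-`). -/
def GluingData (A : ConicLineArrangement k) : Type := {Q : P2 // Q ∈ A.sing} → Bool

open Classical in
/-- The operation on gluing data reversing all the signs at the nodes lying on the
component `C_i`. -/
def flipAt (A : ConicLineArrangement k) (i : Fin k) (κ : GluingData A) : GluingData A :=
  fun Q => if (Q : P2) ∈ A.curve i then !(κ Q) else κ Q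

/-- Two gluing data are equivalent if one is obtained from the other by a finite number of
sign-reversal operations along components. -/
def GluingEquiv (A : ConicLineArrangement k) : GluingData A → GluingData A → Prop :=
  Relation.ReflTransGen (fun κ κ' => ∃ i, κ' = flipAt A i κ)

/-- A labeling of a topological double cover `φ` of the arrangement `C`: a choice, for each
irreducible component `C_i`, of a decomposition `φ⁻¹(C_i) = C_i⁺ ∪ C_i⁻` into two disjoint
subsets, each mapped homeomorphically onto `C_i`. -/
def IsLabeling {C' : Type} [TopologicalSpace C'] (A : ConicLineArrangement k)
    (φ : C' → {x : P2 // x ∈ A.plane}) (piece : Fin k → Bool → Set C') : Prop :=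
  (∀ i, piece i true ∩ piece i false = ∅) ∧
  (∀ i, piece i true ∪ piece i false = φ ⁻¹' {x | (x : P2) ∈ A.curve i}) ∧
  (∀ i ε, SplitsOver (fun y => ((φ y : {x : P2 // x ∈ A.plane}) : P2)) (piece i ε) (A.curve i))

/-- `κ` is the gluing data of the topological double cover `φ` (with respect to some labeling
`C_i⁺`, `C_i⁻` of the halves of the preimages of the components): at a node `Q ∈ C_i ∩ C_j`,
`κ(Q) = +` precisely when `C_i⁺` intersects `C_j⁺` over `Q`. -/
def IsGluingDataOf {C' : Type} [TopologicalSpace C'] (A : ConicLineArrangement k)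
    (φ : C' → {x : P2 // x ∈ A.plane}) (κ : GluingData A) : Prop :=
  ∃ piece : Fin k → Bool → Set C', IsLabeling A φ piece ∧
    ∀ (Q : {Q : P2 // Q ∈ A.sing}) (i j : Fin k), i ≠ j →
      (Q : P2) ∈ A.curve i → (Q : P2) ∈ A.curve j →
      (κ Q = true ↔ ∃ y, y ∈ piece i true ∧ y ∈ piece j true ∧
        ((φ y : {x : P2 // x ∈ A.plane}) : P2) = (Q : P2))

/-- A topological double cover of the arrangement `C`, bundled. -/
structure DoubleCoverOf (A : ConicLineArrangement k) where
  total : Type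
  topo : TopologicalSpace total
  map : total → {x : P2 // x ∈ A.plane}
  is_cover : IsDoubleCover (X := {x : P2 // x ∈ A.plane}) map

attribute [instance] DoubleCoverOf.topo

/-- Two topological double covers of `C` are homeomorphic over `C` if there is a
homeomorphism of total spaces commuting with the covering maps. -/
def HomeoOver {A : ConicLineArrangement k} (D D' : DoubleCoverOf A) : Prop :=
  ∃ h : D.total ≃ₜ D'.total, ∀ y, D'.map (h y) = D.map y

end GluingData

section TwoCharts

open Set Topology

/-- `X` is covered by two open copies of the complex line with nonempty connected overlap. -/
def HasTwoCharts (X : Type*) [TopologicalSpace X] : Prop :=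
  ∃ f g : ℂ → X, IsOpenEmbedding f ∧ IsOpenEmbedding g ∧ range f ∪ range g = univ ∧
    (range f ∩ range g).Nonempty ∧ IsPreconnected (range f ∩ range g)

variable {X E B : Type*} [TopologicalSpace X] [TopologicalSpace E] [TopologicalSpace B]

theorem HasTwoCharts.nonempty (hX : HasTwoCharts X) : Nonempty X :=
  let ⟨f, _⟩ := hX
  ⟨f 0⟩

theorem HasTwoCharts.preconnectedSpace (hX : HasTwoCharts X) : PreconnectedSpace X := by
  obtain ⟨f, g, hf, hg, hu, ⟨z, hz⟩, -⟩ := hX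
  refine ⟨hu ▸ IsPreconnected.union z hz.1 hz.2 ?_ ?_⟩
  · exact isPreconnected_range hf.continuous
  · exact isPreconnected_range hg.continuous

theorem exists_lift_of_mem_range_chart {p : E → B} (hp : IsCoveringMap p) {h : X → B}
    (hh : Continuous h) {f g : ℂ → X} (hf : IsOpenEmbedding f) (hg : IsOpenEmbedding g)
    (hu : range f ∪ range g = univ) (hn : (range f ∩ range g).Nonempty)
    (hc : IsPreconnected (range f ∩ range g)) {x₀ : X} (hx₀ : x₀ ∈ range f) {e₀ : E}
    (he : p e₀ = h x₀) : ∃ s : X → E, Continuous s ∧ p ∘ s = h ∧ s x₀ = e₀ := by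
  classical
  obtain ⟨a₀, rfl⟩ := hx₀
  obtain ⟨F, ⟨hF0, hF⟩, -⟩ := hp.existsUnique_continuousMap_lifts
    ⟨h ∘ f, hh.comp hf.continuous⟩ a₀ e₀ he
  obtain ⟨z, ⟨a, rfl⟩, ⟨b, hb⟩⟩ := hn
  have hF' (t : ℂ) : p (F t) = h (f t) := congrFun hF t
  obtain ⟨G, ⟨hG0, hG⟩, -⟩ := hp.existsUnique_continuousMap_lifts
    ⟨h ∘ g, hh.comp hg.continuous⟩ b (F a) (by rw [hF' a, ← hb]; rfl)
  have hG' (t : ℂ) : p (G t) = h (g t) := congrFun hG t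
  let fi := Function.invFun f
  let gi := Function.invFun g
  have hfi (t : ℂ) : fi (f t) = t := Function.leftInverse_invFun hf.injective t
  have hgi (t : ℂ) : gi (g t) = t := Function.leftInverse_invFun hg.injective t
  have hFc : ContinuousOn (F ∘ fi) (range f) := by
    rintro _ ⟨t, rfl⟩
    apply ContinuousAt.continuousWithinAt
    rw [← hf.continuousAt_iff]
    have : (F ∘ fi) ∘ f = F := funext fun t => by simp [hfi]
    rw [this]; exact F.continuous.continuousAt
  have hGc : ContinuousOn (G ∘ gi) (range g) := by
    rintro _ ⟨t, rfl⟩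
    apply ContinuousAt.continuousWithinAt
    rw [← hg.continuousAt_iff]
    have : (G ∘ gi) ∘ g = G := funext fun t => by simp [hgi]
    rw [this]; exact G.continuous.continuousAt
  have key : (range f ∩ range g).EqOn (F ∘ fi) (G ∘ gi) := by
    refine hp.eqOn_of_comp_eqOn hc (hFc.mono inter_subset_left) (hGc.mono inter_subset_right)
      ?_ ⟨⟨a, rfl⟩, ⟨b, hb⟩⟩ ?_
    · rintro _ ⟨⟨t, rfl⟩, ⟨u, hu⟩⟩
      simp only [Function.comp_apply, hfi, hF']
      rw [← hu, hgi, hG']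
    · simp only [Function.comp_apply, hfi]
      rw [← hb, hgi, hG0]
  let s : X → E := fun x => if x ∈ range f then F (fi x) else G (gi x)
  have hsf (t : ℂ) : s (f t) = F t := by simp [s, hfi]
  have hsg (t : ℂ) : s (g t) = G t := by
    by_cases ht : g t ∈ range f
    · have := key ⟨ht, ⟨t, rfl⟩⟩
      simp only [Function.comp_apply, hgi] at this
      simp only [s, if_pos ht, this]
    · simp only [s, if_neg ht, hgi]
  have hcov (x : X) : x ∈ range f ∪ range g := hu ▸ mem_univ x
  refine ⟨s, ?_, ?_, by rw [hsf, hF0]⟩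
  · rw [continuous_iff_continuousAt]
    intro x
    rcases hcov x with ⟨t, rfl⟩ | ⟨t, rfl⟩
    · rw [← hf.continuousAt_iff, show s ∘ f = F from funext hsf]
      exact F.continuous.continuousAt
    · rw [← hg.continuousAt_iff, show s ∘ g = G from funext hsg]
      exact G.continuous.continuousAt
  · funext x
    rcases hcov x with ⟨t, rfl⟩ | ⟨t, rfl⟩
    · simp [hsf, hF']
    · simp [hsg, hG']

theorem HasTwoCharts.exists_lift (hX : HasTwoCharts X) {p : E → B} (hp : IsCoveringMap p)
    {h : X → B} (hh : Continuous h) {x₀ : X} {e₀ : E} (he : p e₀ = h x₀) :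
    ∃ s : X → E, Continuous s ∧ p ∘ s = h ∧ s x₀ = e₀ := by
  obtain ⟨f, g, hf, hg, hu, hn, hc⟩ := hX
  have hcov : x₀ ∈ range f ∪ range g := hu ▸ mem_univ x₀
  rcases hcov with hx | hx
  · exact exists_lift_of_mem_range_chart hp hh hf hg hu hn hc hx he
  · exact exists_lift_of_mem_range_chart hp hh hg hf (union_comm _ _ ▸ hu) (inter_comm _ _ ▸ hn)
      (inter_comm _ _ ▸ hc) hx he

end TwoCharts

section Geometry

open Set Topology

theorem MvPolynomial.IsHomogeneous.eval_smul_apply {g : MvPolynomial (Fin 3) ℂ} {n : ℕ}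
    (hg : g.IsHomogeneous n) (c : ℂ) (w : Fin 3 → ℂ) :
    eval (c • w) g = c ^ n * eval w g := by
  rw [eval_eq, eval_eq, Finset.mul_sum]
  refine Finset.sum_congr rfl fun d hd => ?_
  have hdeg : ∑ i ∈ d.support, d i = n := by
    have := hg (mem_support_iff.mp hd)
    simpa [Finsupp.weight_apply, Finsupp.sum] using this
  simp only [Pi.smul_apply, smul_eq_mul, mul_pow, Finset.prod_mul_distrib]
  rw [Finset.prod_pow_eq_pow_sum, hdeg]
  ring

theorem isOpen_P2_iff {U : Set P2} :
    IsOpen U ↔ IsOpen {w : {w : Fin 3 → ℂ // w ≠ 0} | Projectivization.mk ℂ w.1 w.2 ∈ U} :=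
  Iff.rfl

theorem continuous_P2_mk {Y : Type*} [TopologicalSpace Y] {v : Y → Fin 3 → ℂ} (hv : Continuous v)
    (h0 : ∀ y, v y ≠ 0) : Continuous fun y => (Projectivization.mk ℂ (v y) (h0 y) : P2) := by
  have h1 : Continuous fun y => (⟨v y, h0 y⟩ : {w : Fin 3 → ℂ // w ≠ 0}) := hv.subtype_mk _
  exact (continuous_quot_mk.comp h1 :)

theorem exists_rep_mk (w : Fin 3 → ℂ) (hw : w ≠ 0) :
    ∃ c : ℂ, c ≠ 0 ∧ (Projectivization.mk ℂ w hw).rep = c • w :=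
  let ⟨a, ha⟩ := Projectivization.exists_smul_eq_mk_rep ℂ w hw
  ⟨a, a.ne_zero, ha.symm⟩

theorem mem_zeroLocus_mk {g : MvPolynomial (Fin 3) ℂ} {n : ℕ} (hg : g.IsHomogeneous n)
    (w : Fin 3 → ℂ) (hw : w ≠ 0) :
    Projectivization.mk ℂ w hw ∈ zeroLocus g ↔ eval w g = 0 := by
  obtain ⟨c, hc, h⟩ := exists_rep_mk w hw
  simp [_root_.zeroLocus, pev, h, hg.eval_smul_apply, hc]

theorem isClosed_zeroLocus {g : MvPolynomial (Fin 3) ℂ} {n : ℕ} (hg : g.IsHomogeneous n) :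
    IsClosed (zeroLocus g) := by
  rw [← isOpen_compl_iff, isOpen_P2_iff]
  have : {w : {w : Fin 3 → ℂ // w ≠ 0} | Projectivization.mk ℂ w.1 w.2 ∈ (zeroLocus g)ᶜ} =
      {w | eval w.1 g = 0}ᶜ := by
    ext w
    simp [mem_zeroLocus_mk hg]
  rw [this, isOpen_compl_iff]
  exact isClosed_eq (g.continuous_eval.comp continuous_subtype_val) continuous_const

instance : T1Space P2 := by
  refine ⟨fun x => ?_⟩
  let g (i j : Fin 3) : MvPolynomial (Fin 3) ℂ := X i * C (x.rep j) - X j * C (x.rep i)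
  have hg (i j) : (g i j).IsHomogeneous 1 :=
    ((isHomogeneous_X ℂ i).mul (isHomogeneous_C _ _)).sub
      ((isHomogeneous_X ℂ j).mul (isHomogeneous_C _ _))
  have : ({x} : Set P2) = ⋂ i, ⋂ j, zeroLocus (g i j) := by
    ext y
    simp only [mem_singleton_iff, mem_iInter]
    constructor
    · rintro rfl i j
      simp [_root_.zeroLocus, pev, g, mul_comm]
    · intro h
      have h' (i j) : y.rep i * x.rep j = y.rep j * x.rep i := by
        have := h i j
        simpa [_root_.zeroLocus, pev, g, sub_eq_zero] using this
      obtain ⟨j, hj⟩ := Function.ne_iff.mp x.rep_nonzero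
      rw [← y.mk_rep, ← x.mk_rep, Projectivization.mk_eq_mk_iff']
      refine ⟨y.rep j / x.rep j, funext fun i => ?_⟩
      have hj' : x.rep j ≠ 0 := hj
      have := h' i j
      simp only [Pi.smul_apply, smul_eq_mul]
      field_simp
      rw [← this, mul_comm]
  rw [this]
  exact isClosed_iInter fun i => isClosed_iInter fun j => isClosed_zeroLocus (hg i j)

/-- A chart `t ↦ [a + t b + t² c]` of a subset `S` of the plane, onto the part of `S` where
the linear form `α` does not vanish; its inverse is given by `β / α`. -/
structure QuadChart (S : Set P2) where
  (a b c : Fin 3 → ℂ)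
  (α β : (Fin 3 → ℂ) →ₗ[ℂ] ℂ)
  α_a : α a = 1
  α_b : α b = 0
  α_c : α c = 0
  β_a : β a = 0
  β_b : β b = 1
  β_c : β c = 0
  vec_ne : ∀ t : ℂ, a + t • b + t ^ 2 • c ≠ 0
  mem : ∀ t : ℂ, Projectivization.mk ℂ (a + t • b + t ^ 2 • c) (vec_ne t) ∈ S
  eq_vec : ∀ (w : Fin 3 → ℂ) (hw : w ≠ 0), Projectivization.mk ℂ w hw ∈ S → α w = 1 →
    w = a + β w • b + β w ^ 2 • c

namespace QuadChart

variable {S : Set P2} (q : QuadChart S)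

def vec (t : ℂ) : Fin 3 → ℂ := q.a + t • q.b + t ^ 2 • q.c

theorem α_vec (t : ℂ) : q.α (q.vec t) = 1 := by simp [vec, q.α_a, q.α_b, q.α_c]

theorem β_vec (t : ℂ) : q.β (q.vec t) = t := by simp [vec, q.β_a, q.β_b, q.β_c]

theorem continuous_vec : Continuous q.vec := by unfold vec; fun_prop

def point (t : ℂ) : P2 := Projectivization.mk ℂ (q.vec t) (q.vec_ne t)

def toFun (t : ℂ) : S := ⟨q.point t, q.mem t⟩

theorem continuous_toFun : Continuous q.toFun :=
  (continuous_P2_mk q.continuous_vec q.vec_ne).subtype_mk _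

theorem mem_image_iff (U : Set ℂ) (x : S) :
    x ∈ q.toFun '' U ↔ q.α (x : P2).rep ≠ 0 ∧ q.β (x : P2).rep / q.α (x : P2).rep ∈ U := by
  constructor
  · rintro ⟨t, ht, rfl⟩
    obtain ⟨c, hc, h⟩ := exists_rep_mk (q.vec t) (q.vec_ne t)
    change q.α (Projectivization.mk ℂ (q.vec t) (q.vec_ne t)).rep ≠ 0 ∧
      q.β (Projectivization.mk ℂ (q.vec t) (q.vec_ne t)).rep /
      q.α (Projectivization.mk ℂ (q.vec t) (q.vec_ne t)).rep ∈ U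
    rw [h, map_smul, map_smul, q.α_vec, q.β_vec]
    simpa [hc] using ht
  · rintro ⟨h0, hU⟩
    refine ⟨_, hU, Subtype.ext ?_⟩
    set w := (q.α (x : P2).rep)⁻¹ • (x : P2).rep with hw
    have hw0 : w ≠ 0 := smul_ne_zero (inv_ne_zero h0) (x : P2).rep_nonzero
    have hx : (x : P2) = Projectivization.mk ℂ w hw0 := by
      conv_lhs => rw [← (x : P2).mk_rep]
      rw [Projectivization.mk_eq_mk_iff']
      exact ⟨q.α (x : P2).rep, by rw [hw, smul_inv_smul₀ h0]⟩
    have hα : q.α w = 1 := by simp [hw, h0]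
    have hβ : q.β w = q.β (x : P2).rep / q.α (x : P2).rep := by simp [hw, div_eq_inv_mul]
    have := q.eq_vec w hw0 (hx ▸ x.2) hα
    rw [hβ] at this
    refine Eq.trans ?_ hx.symm
    change Projectivization.mk ℂ _ _ = _
    congr 1
    exact this.symm

theorem mem_range_iff (x : S) : x ∈ range q.toFun ↔ q.α (x : P2).rep ≠ 0 := by
  rw [← image_univ, mem_image_iff]; simp

theorem injective_toFun : Function.Injective q.toFun := by
  intro t u h
  have key (t : ℂ) : t = q.β (q.toFun t : P2).rep / q.α (q.toFun t : P2).rep := by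
    have := ((q.mem_image_iff {t} (q.toFun t)).1 ⟨t, rfl, rfl⟩).2
    exact this.symm
  rw [key t, key u, h]

theorem isOpenEmbedding_toFun : IsOpenEmbedding q.toFun := by
  refine .of_continuous_injective_isOpenMap q.continuous_toFun q.injective_toFun fun U hU => ?_
  let O : Set P2 := {x | q.α x.rep ≠ 0 ∧ q.β x.rep / q.α x.rep ∈ U}
  have hO : IsOpen O := by
    rw [isOpen_P2_iff]
    have : {w : {w : Fin 3 → ℂ // w ≠ 0} | Projectivization.mk ℂ w.1 w.2 ∈ O} =
        {w | q.α w.1 ≠ 0 ∧ q.β w.1 / q.α w.1 ∈ U} := by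
      ext ⟨w, hw⟩
      obtain ⟨c, hc, h⟩ := exists_rep_mk w hw
      simp only [mem_ofPred_eq, O, h, map_smul, smul_eq_mul]
      rw [mul_div_mul_left _ _ hc]
      simp [hc]
    rw [this]
    have hα : Continuous fun w : {w : Fin 3 → ℂ // w ≠ 0} => q.α w.1 :=
      q.α.continuous_of_finiteDimensional.comp continuous_subtype_val
    have hβ : Continuous fun w : {w : Fin 3 → ℂ // w ≠ 0} => q.β w.1 :=
      q.β.continuous_of_finiteDimensional.comp continuous_subtype_val
    have hV : IsOpen {w : {w : Fin 3 → ℂ // w ≠ 0} | q.α w.1 ≠ 0} :=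
      isOpen_ne_fun hα continuous_const
    have hd : ContinuousOn (fun w : {w : Fin 3 → ℂ // w ≠ 0} => q.β w.1 / q.α w.1)
        {w | q.α w.1 ≠ 0} := hβ.continuousOn.div hα.continuousOn fun w hw => hw
    exact hd.isOpen_inter_preimage hV hU
  have : q.toFun '' U = Subtype.val ⁻¹' O := by
    ext x
    exact q.mem_image_iff U x
  rw [this]
  exact hO.preimage continuous_subtype_val

end QuadChart

/-- Two quadratic charts of `S` covering it, which overlap away from one point. -/
structure QuadAtlas (S : Set P2) where
  (q q' : QuadChart S)
  cover : ∀ x ∈ S, q.α x.rep ≠ 0 ∨ q'.α x.rep ≠ 0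
  overlap : ∀ t, q'.α (q.vec t) ≠ 0 ↔ t ≠ 0

theorem QuadAtlas.hasTwoCharts {S : Set P2} (T : QuadAtlas S) : HasTwoCharts S := by
  have hov : range T.q.toFun ∩ range T.q'.toFun = T.q.toFun '' {0}ᶜ := by
    ext x
    constructor
    · rintro ⟨⟨t, rfl⟩, ht⟩
      rw [T.q'.mem_range_iff] at ht
      obtain ⟨c, hc, h⟩ := exists_rep_mk (T.q.vec t) (T.q.vec_ne t)
      change T.q'.α (Projectivization.mk ℂ (T.q.vec t) (T.q.vec_ne t)).rep ≠ 0 at ht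
      rw [h, map_smul, smul_eq_mul, mul_ne_zero_iff, T.overlap] at ht
      exact ⟨t, ht.2, rfl⟩
    · rintro ⟨t, ht, rfl⟩
      refine ⟨⟨t, rfl⟩, ?_⟩
      rw [T.q'.mem_range_iff]
      obtain ⟨c, hc, h⟩ := exists_rep_mk (T.q.vec t) (T.q.vec_ne t)
      change T.q'.α (Projectivization.mk ℂ (T.q.vec t) (T.q.vec_ne t)).rep ≠ 0
      rw [h, map_smul, smul_eq_mul, mul_ne_zero_iff, T.overlap]
      exact ⟨hc, ht⟩
  refine ⟨T.q.toFun, T.q'.toFun, T.q.isOpenEmbedding_toFun, T.q'.isOpenEmbedding_toFun, ?_, ?_, ?_⟩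
  · rw [eq_univ_iff_forall]
    intro x
    rw [mem_union, T.q.mem_range_iff, T.q'.mem_range_iff]
    exact T.cover x x.2
  · rw [hov]
    exact ⟨_, ⟨1, one_ne_zero, rfl⟩⟩
  · rw [hov]
    refine IsPreconnected.image ?_ _ T.q.continuous_toFun.continuousOn
    exact (isConnected_compl_singleton_of_one_lt_rank (by simp) 0).isPreconnected

end Geometry

section Algebra

open Set Topology

namespace QuadChart

variable {S : Set P2} (q : QuadChart S)

def coord (m : Fin 3) : Polynomial ℂ :=
  Polynomial.C (q.a m) + Polynomial.X * Polynomial.C (q.b m) +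
    Polynomial.X ^ 2 * Polynomial.C (q.c m)

def pull (g : MvPolynomial (Fin 3) ℂ) : Polynomial ℂ := aeval q.coord g

theorem eval_coord (t : ℂ) (m : Fin 3) : (q.coord m).eval t = q.vec t m := by
  simp [coord, vec]
  ring

theorem eval_pull (g : MvPolynomial (Fin 3) ℂ) (t : ℂ) :
    (q.pull g).eval t = eval (q.vec t) g := by
  induction g using MvPolynomial.induction_on with
  | C r => simp [pull]
  | add p r hp hr => simpa [pull] using congrArg₂ (· + ·) hp hr
  | mul_X p m hp =>
    simp only [pull, map_mul, aeval_X, Polynomial.eval_mul, eval_X, eval_coord] at hp ⊢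
    rw [hp]

theorem eval_derivative_pull (g : MvPolynomial (Fin 3) ℂ) :
    (q.pull g).derivative.eval 0 = ∑ m, eval q.a (pderiv m g) * q.b m := by
  induction g using MvPolynomial.induction_on with
  | C r => simp [pull]
  | add p r hp hr =>
    simp only [pull, map_add, Polynomial.eval_add, add_mul, Finset.sum_add_distrib] at hp hr ⊢
    rw [hp, hr]
  | mul_X p m hp =>
    have h0 : eval q.a p = (q.pull p).eval 0 := by rw [eval_pull]; simp [vec]
    have h1 : (q.coord m).eval 0 = q.a m := by simp [coord]
    have h2 : (q.coord m).derivative.eval 0 = q.b m := by simp [coord]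
    have h3 : q.pull (p * X m) = q.pull p * q.coord m := by simp [pull]
    rw [h3, Polynomial.derivative_mul, Polynomial.eval_add, Polynomial.eval_mul,
      Polynomial.eval_mul, hp, h1, h2, ← h0]
    simp only [Derivation.leibniz, pderiv_X, smul_eq_mul, map_add, map_mul, eval_X, add_mul,
      Finset.sum_add_distrib, Finset.sum_mul]
    rw [add_comm]
    congr 1
    · rw [Finset.sum_eq_single m]
      · simp
      · intro i _ hi
        simp [Pi.single_eq_of_ne' hi]
      · simp
    · exact Finset.sum_congr rfl fun i _ => by ring

theorem vec_zero : q.vec 0 = q.a := by simp [vec]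

/-- The gradient at `a` of a form vanishing along a chart is orthogonal to `a` and `b`. -/
theorem gradient_orthogonal {g : MvPolynomial (Fin 3) ℂ} {n : ℕ} (hg : g.IsHomogeneous n)
    (h : q.pull g = 0) :
    ∑ m, eval q.a (pderiv m g) * q.a m = 0 ∧ ∑ m, eval q.a (pderiv m g) * q.b m = 0 := by
  constructor
  · have he := congrArg (eval q.a) hg.sum_X_mul_pderiv
    have h0 : eval q.a g = 0 := by rw [← q.vec_zero, ← eval_pull, h, Polynomial.eval_zero]
    simpa [h0, mul_comm] using he
  · rw [← eval_derivative_pull, h]; simp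

theorem proportional {G G' : Fin 3 → ℂ} (hG : G ≠ 0)
    (h1 : ∑ m, G m * q.a m = 0) (h2 : ∑ m, G m * q.b m = 0)
    (h1' : ∑ m, G' m * q.a m = 0) (h2' : ∑ m, G' m * q.b m = 0) : ∃ c : ℂ, G' = c • G := by
  let Φ : (Fin 3 → ℂ) →ₗ[ℂ] (Fin 2 → ℂ) := Matrix.mulVecLin !![q.a 0, q.a 1, q.a 2; q.b 0, q.b 1, q.b 2]
  have hΦ (H : Fin 3 → ℂ) : Φ H = ![∑ m, H m * q.a m, ∑ m, H m * q.b m] := by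
    ext i
    fin_cases i <;> simp [Φ, Matrix.mulVec, dotProduct, Fin.sum_univ_three, mul_comm]
  have hform (ℓ : (Fin 3 → ℂ) →ₗ[ℂ] ℂ) (w : Fin 3 → ℂ) :
      ∑ m, ℓ (Pi.single m 1) * w m = ℓ w := by
    rw [LinearMap.pi_apply_eq_sum_univ ℓ w]
    exact Finset.sum_congr rfl fun m _ => by
      rw [smul_eq_mul, mul_comm]
      congr 2
      ext j; simp [Pi.single_apply, eq_comm]
  have hsurj : LinearMap.range Φ = ⊤ := by
    rw [LinearMap.range_eq_top]
    intro y
    refine ⟨y 0 • (fun m => q.α (Pi.single m 1)) + y 1 • fun m => q.β (Pi.single m 1), ?_⟩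
    rw [map_add, map_smul, map_smul, hΦ, hΦ, hform, hform, hform, hform, q.α_a, q.α_b, q.β_a, q.β_b]
    ext i
    fin_cases i <;> simp
  have hrank : Module.finrank ℂ (LinearMap.ker Φ) = 1 := by
    have := Φ.finrank_range_add_finrank_ker
    rw [hsurj, finrank_top] at this
    simp at this
    omega
  have hk : G ∈ LinearMap.ker Φ := by
    rw [LinearMap.mem_ker, hΦ, h1, h2]; simp
  have hk' : G' ∈ LinearMap.ker Φ := by
    rw [LinearMap.mem_ker, hΦ, h1', h2']; simp
  have hne : (⟨G, hk⟩ : LinearMap.ker Φ) ≠ 0 := fun h => hG (congrArg Subtype.val h)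
  obtain ⟨c, hc⟩ := (finrank_eq_one_iff_of_nonzero' _ hne).1 hrank ⟨G', hk'⟩
  exact ⟨c, (congrArg Subtype.val hc).symm⟩

end QuadChart

variable {k : ℕ} (A : ConicLineArrangement k)

theorem ConicLineArrangement.pull_ne_zero {i j : Fin k} (hij : i ≠ j)
    (q : QuadChart (A.curve i)) : q.pull (A.f j) ≠ 0 := by
  intro hj
  have hi : q.pull (A.f i) = 0 := by
    refine Polynomial.funext fun t => ?_
    rw [q.eval_pull, Polynomial.eval_zero]
    exact (mem_zeroLocus_mk (A.homog i) _ (q.vec_ne t)).1 (q.mem t)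
  obtain ⟨h1, h2⟩ := q.gradient_orthogonal (A.homog i) hi
  obtain ⟨h1', h2'⟩ := q.gradient_orthogonal (A.homog j) hj
  have ha : q.a ≠ 0 := q.vec_zero ▸ q.vec_ne 0
  let x : P2 := Projectivization.mk ℂ q.a ha
  obtain ⟨u, hu, hx⟩ := exists_rep_mk q.a ha
  have hxi : x ∈ _root_.zeroLocus (A.f i) := by
    rw [mem_zeroLocus_mk (A.homog i), ← q.vec_zero, ← q.eval_pull, hi, Polynomial.eval_zero]
  have hxj : x ∈ _root_.zeroLocus (A.f j) := by
    rw [mem_zeroLocus_mk (A.homog j), ← q.vec_zero, ← q.eval_pull, hj, Polynomial.eval_zero]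
  have hpev (l : Fin k) (m : Fin 3) :
      pev (pderiv m (A.f l)) x = u ^ (A.deg l - 1) * eval q.a (pderiv m (A.f l)) := by
    rw [pev, hx, (A.homog l).pderiv.eval_smul_apply]
  have hG : (fun m => eval q.a (pderiv m (A.f i))) ≠ 0 := by
    intro h0
    obtain ⟨m, hm⟩ := A.smooth i x hxi
    apply hm
    rw [hpev, congrFun h0 m]; simp
  obtain ⟨c, hc⟩ := q.proportional hG h1 h2 h1' h2'
  refine (A.nodes i j hij x ⟨hxi, hxj⟩).2
    ⟨u ^ (A.deg j - 1) * c / u ^ (A.deg i - 1), fun m => ?_⟩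
  rw [hpev, hpev, congrFun hc m]
  simp only [Pi.smul_apply, smul_eq_mul]
  field_simp

theorem ConicLineArrangement.finite_curve_inter {i j : Fin k} (hij : i ≠ j)
    (T : QuadAtlas (A.curve i)) : (A.curve i ∩ A.curve j).Finite := by
  have hfin (q : QuadChart (A.curve i)) : (q.point '' {t | (q.pull (A.f j)).IsRoot t}).Finite :=
    (Polynomial.finite_setOfPred_isRoot (A.pull_ne_zero hij q)).image _
  refine ((hfin T.q).union (hfin T.q')).subset ?_
  rintro x ⟨hxi, hxj⟩
  have key (q : QuadChart (A.curve i)) (hq : q.α x.rep ≠ 0) :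
      x ∈ q.point '' {t | (q.pull (A.f j)).IsRoot t} := by
    obtain ⟨t, ht⟩ := (q.mem_range_iff ⟨x, hxi⟩).2 hq
    have ht' : q.point t = x := congrArg Subtype.val ht
    refine ⟨t, ?_, ht'⟩
    change (q.pull (A.f j)).eval t = 0
    rw [q.eval_pull]
    refine (mem_zeroLocus_mk (A.homog j) _ (q.vec_ne t)).1 ?_
    change q.point t ∈ A.curve j
    rwa [ht']
  exact (T.cover x hxi).imp (key _) (key _)

end Algebra

section Atlas

open Set Topology

theorem MvPolynomial.IsHomogeneous.eval_of_degree_zero {g : MvPolynomial (Fin 3) ℂ}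
    (hg : g.IsHomogeneous 0) (w : Fin 3 → ℂ) : eval w g = eval 0 g := by
  simpa using (hg.eval_smul_apply 0 w).symm

theorem exists_coeffs_of_isHomogeneous_one {f : MvPolynomial (Fin 3) ℂ} (hf : f.IsHomogeneous 1) :
    ∃ g : Fin 3 → ℂ, ∀ w, eval w f = ∑ m, g m * w m := by
  refine ⟨fun m => eval 0 (pderiv m f), fun w => ?_⟩
  have h := congrArg (eval w) hf.sum_X_mul_pderiv
  simp only [map_sum, map_mul, eval_X, one_smul] at h
  rw [← h]
  refine Finset.sum_congr rfl fun m _ => ?_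
  rw [(hf.pderiv (i := m)).eval_of_degree_zero w, mul_comm]

theorem Fin.univ_three_eq {p r m : Fin 3} (hpr : p ≠ r) (hpm : p ≠ m) (hrm : r ≠ m) :
    (Finset.univ : Finset (Fin 3)) = {p, r, m} := by
  revert p r m
  decide

/-- The atlas of the line `∑ g_m w_m = 0`, in which `w_{m₀}` is eliminated. -/
theorem nonempty_quadAtlas_line {f : MvPolynomial (Fin 3) ℂ} (hf : f.IsHomogeneous 1)
    (h0 : f ≠ 0) : Nonempty (QuadAtlas (_root_.zeroLocus f)) := by
  obtain ⟨g, hg⟩ := exists_coeffs_of_isHomogeneous_one hf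
  obtain ⟨m, hm⟩ : ∃ m, g m ≠ 0 := by
    by_contra! h
    exact h0 (MvPolynomial.funext fun w => by simp [hg, h])
  let e (p : Fin 3) : Fin 3 → ℂ := Pi.single p 1 - (g p / g m) • Pi.single m 1
  have hsum {p r : Fin 3} (hpr : p ≠ r) (hpm : p ≠ m) (hrm : r ≠ m) (F : Fin 3 → ℂ) :
      ∑ i, F i = F p + F r + F m := by
    rw [Fin.univ_three_eq hpr hpm hrm, Finset.sum_insert (by simp [hpr, hpm]),
      Finset.sum_pair hrm, add_assoc]
  have hcases {p r : Fin 3} (hpr : p ≠ r) (hpm : p ≠ m) (hrm : r ≠ m) (i : Fin 3) :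
      i = p ∨ i = r ∨ i = m := by
    have := Finset.mem_univ i
    rw [Fin.univ_three_eq hpr hpm hrm] at this
    simpa using this
  have hchart (p r : Fin 3) (hpr : p ≠ r) (hpm : p ≠ m) (hrm : r ≠ m) :
      ∃ q : QuadChart (_root_.zeroLocus f),
        q.α = LinearMap.proj p ∧ ∀ t, q.vec t = e p + t • e r := by
    have hne (t : ℂ) : e p + t • e r + t ^ 2 • (0 : Fin 3 → ℂ) ≠ 0 := by
      intro h
      have := congrFun h p
      simp [e, hpr, hpm] at this
    refine ⟨⟨e p, e r, 0, LinearMap.proj p, LinearMap.proj r, ?_, ?_, ?_, ?_, ?_, ?_, hne, ?_, ?_⟩,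
      rfl, ?_⟩
    · simp [e, hpm]
    · simp [e, hpm, hpr]
    · simp
    · simp [e, hrm, hpr.symm]
    · simp [e, hrm]
    · simp
    · intro t
      rw [mem_zeroLocus_mk hf, hg, hsum hpr hpm hrm]
      simp [e, hpr, hpm, hrm, hpr.symm, hpm.symm, hrm.symm]
      field_simp
      ring
    · intro w hw hS hp
      rw [mem_zeroLocus_mk hf, hg, hsum hpr hpm hrm] at hS
      have hp' : w p = 1 := hp
      have hwm : w m = - (g p + g r * w r) / g m := by
        rw [eq_div_iff hm, ← mul_one (g p), ← hp']; linear_combination hS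
      ext i
      rcases hcases hpr hpm hrm i with rfl | rfl | rfl
      · simp [e, hpr, hpm, hp']
      · simp [e, hpr.symm, hrm]
      · simp [e, hpm.symm, hrm.symm, hwm]
        field_simp
        ring
    · intro t
      simp [QuadChart.vec]
  obtain ⟨p, r, hpr, hpm, hrm⟩ : ∃ p r : Fin 3, p ≠ r ∧ p ≠ m ∧ r ≠ m := by
    fin_cases m
    · exact ⟨1, 2, by decide⟩
    · exact ⟨0, 2, by decide⟩
    · exact ⟨0, 1, by decide⟩
  obtain ⟨q, hq, hv⟩ := hchart p r hpr hpm hrm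
  obtain ⟨q', hq', -⟩ := hchart r p hpr.symm hrm hpm
  refine ⟨⟨q, q', fun x hx => ?_, fun t => ?_⟩⟩
  · by_contra! h
    rw [hq, hq'] at h
    have h1 : x.rep p = 0 := h.1
    have h2 : x.rep r = 0 := h.2
    have h3 : eval x.rep f = 0 := hx
    rw [hg, hsum hpr hpm hrm, h1, h2] at h3
    have h4 : x.rep m = 0 := by simpa [hm] using h3
    apply x.rep_nonzero
    ext i
    rcases hcases hpr hpm hrm i with rfl | rfl | rfl <;> simpa
  · rw [hq', hv]
    simp [e, hpr.symm, hrm]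

theorem MvPolynomial.pderiv_pderiv_comm (i j : Fin 3) (f : MvPolynomial (Fin 3) ℂ) :
    pderiv i (pderiv j f) = pderiv j (pderiv i f) := by
  have h : ⁅pderiv (R := ℂ) i, pderiv (R := ℂ) j⁆ = 0 := by
    refine derivation_ext fun l => ?_
    have hX (i l : Fin 3) : pderiv i (X l : MvPolynomial (Fin 3) ℂ) = C (if l = i then 1 else 0) := by
      rw [pderiv_X, Pi.single_apply]; split_ifs <;> simp
    rw [Derivation.commutator_apply, hX, hX, pderiv_C, pderiv_C, sub_zero, Derivation.zero_apply]
  have := congrArg (fun D => D f) h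
  simpa [Derivation.commutator_apply, sub_eq_zero] using this

/-- A form of degree two is given by its Hessian matrix. -/
theorem exists_hessian {f : MvPolynomial (Fin 3) ℂ} (hf : f.IsHomogeneous 2) :
    ∃ M : Matrix (Fin 3) (Fin 3) ℂ, (∀ i j, M i j = M j i) ∧
      (∀ w i, eval w (pderiv i f) = ∑ j, M i j * w j) ∧
      ∀ w, 2 * eval w f = ∑ i, ∑ j, w i * M i j * w j := by
  have h1 (w : Fin 3 → ℂ) (i : Fin 3) :
      eval w (pderiv i f) = ∑ j, eval 0 (pderiv j (pderiv i f)) * w j := by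
    have h := congrArg (eval w) (hf.pderiv (i := i)).sum_X_mul_pderiv
    simp only [map_sum, map_mul, eval_X, Nat.add_one_sub_one, one_smul] at h
    rw [← h]
    refine Finset.sum_congr rfl fun j _ => ?_
    rw [((hf.pderiv (i := i)).pderiv (i := j)).eval_of_degree_zero w, mul_comm]
  refine ⟨fun i j => eval 0 (pderiv j (pderiv i f)), fun i j => ?_, h1, fun w => ?_⟩
  · dsimp only
    rw [pderiv_pderiv_comm]
  · have h := congrArg (eval w) hf.sum_X_mul_pderiv
    simp only [map_sum, map_mul, eval_X, nsmul_eq_mul, Nat.cast_ofNat, map_ofNat] at h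
    rw [← h]
    refine Finset.sum_congr rfl fun i _ => ?_
    rw [h1, Finset.mul_sum]
    exact Finset.sum_congr rfl fun j _ => by ring

theorem exists_diagonalization {f : MvPolynomial (Fin 3) ℂ} (hf : f.IsHomogeneous 2)
    (hs : ∀ x : P2, pev f x = 0 → ∃ m : Fin 3, pev (pderiv m f) x ≠ 0) :
    ∃ e : (Fin 3 → ℂ) ≃ₗ[ℂ] (Fin 3 → ℂ), ∀ w, 2 * eval w f = ∑ i, e w i * e w i := by
  obtain ⟨M, hsymm, hgrad, hM⟩ := exists_hessian hf
  let B : LinearMap.BilinForm ℂ (Fin 3 → ℂ) := Matrix.toLinearMap₂' ℂ M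
  have hB (v w : Fin 3 → ℂ) : B v w = ∑ i, ∑ j, v i * M i j * w j := by
    simp only [B, Matrix.toLinearMap₂'_apply, smul_eq_mul]
    exact Finset.sum_congr rfl fun i _ => Finset.sum_congr rfl fun j _ => by ring
  have hBsymm (v w : Fin 3 → ℂ) : B v w = B w v := by
    rw [hB, hB, Finset.sum_comm]
    exact Finset.sum_congr rfl fun i _ => Finset.sum_congr rfl fun j _ => by
      rw [hsymm j i]; ring
  let Q : QuadraticForm ℂ (Fin 3 → ℂ) := LinearMap.BilinMap.toQuadraticMap B
  have hQ (w : Fin 3 → ℂ) : Q w = 2 * eval w f := by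
    rw [hM, ← hB]; rfl
  have hass : QuadraticMap.associated (R := ℂ) Q = B := by
    refine LinearMap.ext₂ fun v w => ?_
    rw [QuadraticMap.associated_toQuadraticMap, hBsymm w v, invOf_smul_eq_iff, two_smul]
  have hnd : (QuadraticMap.associated (R := ℂ) Q).SeparatingLeft := by
    rw [hass]
    intro v hv
    by_contra h0
    have hg (m : Fin 3) : eval v (pderiv m f) = 0 := by
      have := hv (Pi.single m 1)
      rw [hBsymm, hB, Finset.sum_eq_single m (fun i _ hi => by simp [hi]) (by simp)] at this
      rw [hgrad]
      simpa using this
    have hf0 : eval v f = 0 := by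
      have := hv v
      rw [hB, ← hM] at this
      simpa using this
    obtain ⟨c, hc, hx⟩ := exists_rep_mk v h0
    obtain ⟨m, hm⟩ := hs (Projectivization.mk ℂ v h0) ((mem_zeroLocus_mk hf v h0).2 hf0)
    apply hm
    rw [pev, hx, hf.pderiv.eval_smul_apply, hg, mul_zero]
  have heq := QuadraticForm.equivalent_weightedSumSquares_of_isAlgClosed Q hnd
  rw [Module.finrank_fin_fun] at heq
  obtain ⟨e⟩ := heq
  refine ⟨e.toLinearEquiv, fun w => ?_⟩
  rw [← hQ, ← e.map_app w, QuadraticMap.weightedSumSquares_apply]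
  simp

/-- The atlas of a smooth conic, from the normal form `z₁² = z₀ z₂`. -/
theorem nonempty_quadAtlas_conic {f : MvPolynomial (Fin 3) ℂ} (hf : f.IsHomogeneous 2)
    (hs : ∀ x : P2, pev f x = 0 → ∃ m : Fin 3, pev (pderiv m f) x ≠ 0) :
    Nonempty (QuadAtlas (_root_.zeroLocus f)) := by
  obtain ⟨e, he⟩ := exists_diagonalization hf hs
  have hI := Complex.I_mul_I
  have hchart (σ : ℂ) (hσ : σ * σ = 1) : ∃ q : QuadChart (_root_.zeroLocus f),
      (∀ w, q.α w = σ * e w 0 + Complex.I * e w 1) ∧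
      ∀ t, e (q.vec t) 0 = σ * (1 - t ^ 2) / 2 ∧ e (q.vec t) 1 = -Complex.I * (1 + t ^ 2) / 2 := by
    let a := e.symm ![σ / 2, -Complex.I / 2, 0]
    let b := e.symm ![0, 0, 1]
    let c := e.symm ![-σ / 2, -Complex.I / 2, 0]
    let α : (Fin 3 → ℂ) →ₗ[ℂ] ℂ :=
      (σ • LinearMap.proj 0 + Complex.I • LinearMap.proj 1) ∘ₗ e.toLinearMap
    let β : (Fin 3 → ℂ) →ₗ[ℂ] ℂ := LinearMap.proj 2 ∘ₗ e.toLinearMap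
    have hα (w) : α w = σ * e w 0 + Complex.I * e w 1 := by simp [α]
    have hβ (w) : β w = e w 2 := by simp [β]
    have hev (t : ℂ) : e (a + t • b + t ^ 2 • c) =
        ![σ * (1 - t ^ 2) / 2, -Complex.I * (1 + t ^ 2) / 2, t] := by
      simp only [a, b, c, map_add, map_smul, LinearEquiv.apply_symm_apply]
      ext i
      fin_cases i <;> simp <;> ring
    have hαv (t : ℂ) : α (a + t • b + t ^ 2 • c) = 1 := by
      rw [hα, hev]
      simp
      linear_combination (1 - t ^ 2) / 2 * hσ - (1 + t ^ 2) / 2 * hI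
    refine ⟨⟨a, b, c, α, β, ?_, ?_, ?_, ?_, ?_, ?_, fun t h => ?_, ?_, ?_⟩, hα, fun t => ?_⟩
    · simpa using hαv 0
    · simp [hα, b]
    · simp [hα, c]
      linear_combination -hσ / 2 - hI / 2
    · simp [hβ, a]
    · simp [hβ, b]
    · simp [hβ, c]
    · have := hαv t
      rw [h, map_zero] at this
      exact zero_ne_one this
    · intro t
      rw [mem_zeroLocus_mk hf]
      have := he (a + t • b + t ^ 2 • c)
      rw [hev, Fin.sum_univ_three] at this
      simp at this
      have h2 : 2 * eval (a + t • b + t ^ 2 • c) f = 0 := by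
        rw [this]
        linear_combination (1 - t ^ 2) ^ 2 / 4 * hσ + (1 + t ^ 2) ^ 2 / 4 * hI
      simpa using h2
    · intro w hw hS hw1
      rw [mem_zeroLocus_mk hf] at hS
      have := he w
      rw [hS, Fin.sum_univ_three] at this
      rw [hα] at hw1
      apply e.injective
      rw [hev, hβ]
      have h1 : e w 2 ^ 2 = - (σ * e w 0 - Complex.I * e w 1) := by
        linear_combination - this - (σ * e w 0 - Complex.I * e w 1) * hw1 + e w 0 ^ 2 * hσ
          - e w 1 ^ 2 * hI
      ext i
      fin_cases i
      · simp [h1]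
        linear_combination - e w 0 * hσ + σ / 2 * hw1
      · simp [h1]
        linear_combination - Complex.I / 2 * hw1 + e w 1 * hI
      · simp
    · have := hev t
      exact ⟨congrFun this 0, congrFun this 1⟩
  obtain ⟨q, hq, hv⟩ := hchart 1 (by norm_num)
  obtain ⟨q', hq', -⟩ := hchart (-1) (by norm_num)
  refine ⟨⟨q, q', fun x hx => ?_, fun t => ?_⟩⟩
  · by_contra! h
    rw [hq, hq'] at h
    have h1 : e x.rep 0 = 0 := by linear_combination (h.1 - h.2) / 2
    have h2 : e x.rep 1 = 0 := by linear_combination -Complex.I * (h.1 + h.2) / 2 + e x.rep 1 * hI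
    have hx' : eval x.rep f = 0 := hx
    have h3 := he x.rep
    rw [hx', Fin.sum_univ_three, h1, h2] at h3
    have h4 : e x.rep 2 = 0 := by simpa using h3.symm
    apply x.rep_nonzero
    apply e.injective
    rw [map_zero]
    ext i
    fin_cases i <;> simpa
  · rw [hq', (hv t).1, (hv t).2]
    have : -1 * (1 * (1 - t ^ 2) / 2) + Complex.I * (-Complex.I * (1 + t ^ 2) / 2) = t ^ 2 := by
      linear_combination -(1 + t ^ 2) / 2 * hI
    rw [this]
    simp

theorem ConicLineArrangement.nonempty_quadAtlas {k : ℕ} (A : ConicLineArrangement k) (i : Fin k) :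
    Nonempty (QuadAtlas (A.curve i)) := by
  have h := A.homog i
  rcases A.deg_one_or_two i with hd | hd
  · exact nonempty_quadAtlas_line (hd ▸ h) (A.ne_zero i)
  · exact nonempty_quadAtlas_conic (hd ▸ h) (A.smooth i)

theorem ConicLineArrangement.hasTwoCharts {k : ℕ} (A : ConicLineArrangement k) (i : Fin k) :
    HasTwoCharts (A.curve i) :=
  (A.nonempty_quadAtlas i).some.hasTwoCharts

theorem ConicLineArrangement.isClosed_curve {k : ℕ} (A : ConicLineArrangement k) (i : Fin k) :
    IsClosed (A.curve i) :=
  isClosed_zeroLocus (A.homog i)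

theorem ConicLineArrangement.finite_sing {k : ℕ} (A : ConicLineArrangement k) :
    A.sing.Finite := by
  have : A.sing ⊆ ⋃ i, ⋃ j, {x | i ≠ j ∧ x ∈ A.curve i ∧ x ∈ A.curve j} := by
    rintro x ⟨i, j, h⟩
    exact mem_iUnion₂.2 ⟨i, j, h⟩
  refine (finite_iUnion fun i => finite_iUnion fun j => ?_).subset this
  by_cases hij : i = j
  · simp [hij]
  · exact (A.finite_curve_inter hij (A.nonempty_quadAtlas i).some).subset fun x hx => hx.2

end Atlas

section Sections

open Set Topology

variable {k : ℕ} {A : ConicLineArrangement k} {C' : Type}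

/-- The gluing data `κ` records which sections of `s` meet over the nodes. -/
def Glues (s : ∀ i, Bool → A.curve i → C') (κ : GluingData A) : Prop :=
  ∀ (Q : {Q : P2 // Q ∈ A.sing}) (i j : Fin k), i ≠ j →
    ∀ (hi : (Q : P2) ∈ A.curve i) (hj : (Q : P2) ∈ A.curve j),
      (κ Q = true ↔ s i true ⟨Q, hi⟩ = s j true ⟨Q, hj⟩)

theorem exists_glues (s : ∀ i, Bool → A.curve i → C') : ∃ κ : GluingData A, Glues s κ := by
  classical
  refine ⟨fun Q => decide (∃ i j, i ≠ j ∧ ∃ (hi : (Q : P2) ∈ A.curve i) (hj : (Q : P2) ∈ A.curve j),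
    s i true ⟨Q, hi⟩ = s j true ⟨Q, hj⟩), fun Q i j hij hi hj => ?_⟩
  rw [decide_eq_true_iff]
  constructor
  · rintro ⟨i', j', hij', hi', hj', h⟩
    have hn := (A.nodes i j hij Q ⟨hi, hj⟩).1
    rcases hn i' hi' with rfl | rfl <;> rcases hn j' hj' with rfl | rfl
    · exact absurd rfl hij'
    · exact h
    · exact h.symm
    · exact absurd rfl hij'
  · exact fun h => ⟨i, j, hij, hi, hj, h⟩

theorem Glues.unique {s : ∀ i, Bool → A.curve i → C'} {κ κ' : GluingData A} (h : Glues s κ)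
    (h' : Glues s κ') : κ = κ' := by
  funext Q
  obtain ⟨i, j, hij, hi, hj⟩ := Q.2
  rw [Bool.eq_iff_iff, h Q i j hij hi hj, h' Q i j hij hi hj]

/-- Exchange the two sections over the components selected by `σ`. -/
def twist (σ : Fin k → Bool) (s : ∀ i, Bool → A.curve i → C') : ∀ i, Bool → A.curve i → C' :=
  fun i ε => s i (xor ε (σ i))

theorem twist_twist (σ τ : Fin k → Bool) (s : ∀ i, Bool → A.curve i → C') :
    twist σ (twist τ s) = twist (fun i => xor (σ i) (τ i)) s := by
  funext i ε
  simp [twist]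

variable [TopologicalSpace C']

/-- A labeling of a double cover `φ`, presented as two disjoint continuous sections of `φ` over
each component. -/
structure IsSectionFamily (A : ConicLineArrangement k) (φ : C' → {x : P2 // x ∈ A.plane})
    (s : ∀ i, Bool → A.curve i → C') : Prop where
  continuous : ∀ i ε, Continuous (s i ε)
  map_apply : ∀ i ε x, (φ (s i ε x) : P2) = x
  ne : ∀ i x, s i true x ≠ s i false x

theorem IsDoubleCover.eq_or_eq {E X : Type*} [TopologicalSpace E] [TopologicalSpace X] {φ : E → X}
    (hφ : IsDoubleCover φ) {a b y : E} (ha : φ a = φ y) (hb : φ b = φ y) (hab : a ≠ b) :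
    y = a ∨ y = b := by
  have hcard := hφ.2 (φ y)
  rw [Nat.card_coe_set_eq, Set.ncard_eq_two] at hcard
  obtain ⟨u, v, -, huv⟩ := hcard
  have key (z : E) (hz : φ z = φ y) : z = u ∨ z = v := by
    have : z ∈ φ ⁻¹' {φ y} := hz
    rw [huv] at this
    exact this
  rcases key a ha with h1 | h1 <;> rcases key b hb with h2 | h2 <;>
    rcases key y rfl with h3 | h3 <;> subst_vars <;> simp_all

namespace IsSectionFamily

variable {φ : C' → {x : P2 // x ∈ A.plane}} {s s' : ∀ i, Bool → A.curve i → C'} {κ κ' : GluingData A}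

theorem map_eq (hs : IsSectionFamily A φ s) {y : C'} {i : Fin k} (h : (φ y : P2) ∈ A.curve i)
    (ε : Bool) : φ (s i ε ⟨φ y, h⟩) = φ y :=
  Subtype.ext (hs.map_apply i ε _)

theorem ne_not (hs : IsSectionFamily A φ s) (i : Fin k) (ε : Bool) (x : A.curve i) :
    s i ε x ≠ s i (!ε) x := by
  cases ε
  · exact (hs.ne i x).symm
  · exact hs.ne i x

theorem sheet_injective (hs : IsSectionFamily A φ s) {i : Fin k} {ε δ : Bool} {x : A.curve i} :
    s i ε x = s i δ x ↔ ε = δ := by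
  refine ⟨fun h => ?_, fun h => by rw [h]⟩
  by_contra hne
  obtain rfl : δ = !ε := by cases ε <;> cases δ <;> simp_all
  exact hs.ne_not i ε x h

theorem exists_eq (hs : IsSectionFamily A φ s) (hφ : IsDoubleCover φ) {y : C'} {i : Fin k}
    (h : (φ y : P2) ∈ A.curve i) : ∃ ε, y = s i ε ⟨φ y, h⟩ := by
  rcases hφ.eq_or_eq (hs.map_eq h true) (hs.map_eq h false) (hs.ne i _) with h | h
  · exact ⟨true, h⟩
  · exact ⟨false, h⟩

theorem exists_eq' (hs : IsSectionFamily A φ s) (hφ : IsDoubleCover φ) {y : C'} {i : Fin k}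
    (x : A.curve i) (h : (φ y : P2) = x) : ∃ ε, y = s i ε x := by
  obtain ⟨x, hx⟩ := x
  subst h
  exact hs.exists_eq hφ hx

theorem glue_iff (hs : IsSectionFamily A φ s) (hφ : IsDoubleCover φ) (hκ : Glues s κ)
    (Q : {Q : P2 // Q ∈ A.sing}) {i j : Fin k} (hij : i ≠ j) (hi : (Q : P2) ∈ A.curve i)
    (hj : (Q : P2) ∈ A.curve j) (ε δ : Bool) :
    s i ε ⟨Q, hi⟩ = s j δ ⟨Q, hj⟩ ↔ (κ Q = true ↔ ε = δ) := by
  have h1 : s i true ⟨Q, hi⟩ ≠ s i false ⟨Q, hi⟩ := hs.ne _ _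
  have h2 : s j true ⟨Q, hj⟩ ≠ s j false ⟨Q, hj⟩ := hs.ne _ _
  obtain ⟨ε₁, h3⟩ := hs.exists_eq' hφ (y := s i true ⟨Q, hi⟩) ⟨Q, hj⟩ (hs.map_apply _ _ _)
  obtain ⟨ε₂, h4⟩ := hs.exists_eq' hφ (y := s i false ⟨Q, hi⟩) ⟨Q, hj⟩ (hs.map_apply _ _ _)
  have h5 := hκ Q i j hij hi hj
  have h6 := h1.symm
  have h7 := h2.symm
  cases hq : κ Q <;> cases ε₁ <;> cases ε₂ <;> cases ε <;> cases δ <;> simp_all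

end IsSectionFamily

theorem isGluingDataOf_iff {φ : C' → {x : P2 // x ∈ A.plane}} (hφ : IsDoubleCover φ)
    {κ : GluingData A} :
    IsGluingDataOf A φ κ ↔ ∃ s, IsSectionFamily A φ s ∧ Glues s κ := by
  constructor
  · rintro ⟨piece, ⟨hdisj, -, hsplit⟩, hκ⟩
    let s (i : Fin k) (ε : Bool) (x : A.curve i) : piece i ε :=
      (hsplit i ε).1.toHomeomorph.symm ⟨x, (hsplit i ε).2.symm ▸ x.2⟩
    have hs (i : Fin k) (ε : Bool) (x : A.curve i) : (φ (s i ε x : C') : P2) = x := by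
      have := (hsplit i ε).1.toHomeomorph.apply_symm_apply ⟨x, (hsplit i ε).2.symm ▸ x.2⟩
      exact congrArg Subtype.val this
    have huniq {i : Fin k} {ε : Bool} {y : C'} (hy : y ∈ piece i ε) (x : A.curve i)
        (hx : (φ y : P2) = x) : y = s i ε x := by
      have : (⟨y, hy⟩ : piece i ε) = s i ε x :=
        (hsplit i ε).1.injective (hx.trans (hs i ε x).symm)
      exact congrArg Subtype.val this
    refine ⟨fun i ε x => s i ε x, ⟨fun i ε => ?_, hs, fun i x h => ?_⟩, fun Q i j hij hi hj => ?_⟩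
    · exact continuous_subtype_val.comp ((hsplit i ε).1.toHomeomorph.symm.continuous.comp
        (continuous_subtype_val.subtype_mk _))
    · have : (s i true x : C') ∈ piece i true ∩ piece i false :=
        ⟨(s i true x).2, h ▸ (s i false x).2⟩
      rw [hdisj i] at this
      exact this
    · rw [hκ Q i j hij hi hj]
      constructor
      · rintro ⟨y, hyi, hyj, hy⟩
        exact (huniq hyi ⟨Q, hi⟩ hy).symm.trans (huniq hyj ⟨Q, hj⟩ hy)
      · intro h
        refine ⟨s i true ⟨Q, hi⟩, (s i true ⟨Q, hi⟩).2, ?_, hs _ _ _⟩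
        dsimp only at h
        rw [h]
        exact (s j true ⟨Q, hj⟩).2
  · rintro ⟨s, hs, hκ⟩
    refine ⟨fun i ε => range (s i ε), ⟨fun i => ?_, fun i => ?_, fun i ε => ⟨?_, ?_⟩⟩,
      fun Q i j hij hi hj => ?_⟩
    · rw [eq_empty_iff_forall_notMem]
      rintro _ ⟨⟨x, rfl⟩, ⟨x', h⟩⟩
      obtain rfl : x' = x := Subtype.ext (by rw [← hs.map_apply i true x, ← h, hs.map_apply])
      exact hs.ne i x' h.symm
    · ext y
      constructor
      · rintro (⟨x, rfl⟩ | ⟨x, rfl⟩)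
        · change (φ (s i true x) : P2) ∈ A.curve i
          rw [hs.map_apply]; exact x.2
        · change (φ (s i false x) : P2) ∈ A.curve i
          rw [hs.map_apply]; exact x.2
      · intro hy
        obtain ⟨ε, h⟩ := hs.exists_eq hφ (i := i) hy
        cases ε
        · exact Or.inr ⟨_, h.symm⟩
        · exact Or.inl ⟨_, h.symm⟩
    · have hmem (y : range (s i ε)) : (φ y : P2) ∈ A.curve i := by
        obtain ⟨_, x, rfl⟩ := y
        rw [hs.map_apply]; exact x.2
      let r : range (s i ε) → A.curve i := fun y => ⟨φ y, hmem y⟩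
      have hφc : Continuous fun y : C' => (φ y : P2) :=
        continuous_subtype_val.comp hφ.1.continuous
      have hr : Continuous r := (hφc.comp continuous_subtype_val).subtype_mk _
      have hinv : Function.LeftInverse (rangeFactorization (s i ε)) r := by
        rintro ⟨_, x, rfl⟩
        refine Subtype.ext ?_
        change s i ε ⟨φ (s i ε x), _⟩ = s i ε x
        congr 1
        exact Subtype.ext (hs.map_apply i ε x)
      have hemb : IsEmbedding r := hinv.isEmbedding (hs.continuous i ε).rangeFactorization hr
      have hval : IsEmbedding (Subtype.val : A.curve i → P2) := .subtypeVal
      exact hval.comp hemb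
    · ext x
      constructor
      · rintro ⟨⟨_, x, rfl⟩, rfl⟩
        change (φ (s i ε x) : P2) ∈ A.curve i
        rw [hs.map_apply]; exact x.2
      · intro hx
        exact ⟨⟨s i ε ⟨x, hx⟩, ⟨_, rfl⟩⟩, hs.map_apply _ _ _⟩
    · rw [hκ Q i j hij hi hj]
      constructor
      · intro h
        exact ⟨s i true ⟨Q, hi⟩, ⟨_, rfl⟩, ⟨_, h.symm⟩, hs.map_apply _ _ _⟩
      · rintro ⟨y, ⟨x, rfl⟩, ⟨x', h⟩, hQ⟩
        obtain rfl : x = ⟨Q, hi⟩ := Subtype.ext (by rw [← hs.map_apply i true x, hQ])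
        obtain rfl : x' = ⟨Q, hj⟩ := Subtype.ext (by rw [← hs.map_apply j true x', h, hQ])
        exact h.symm

theorem ConicLineArrangement.curve_subset_plane (A : ConicLineArrangement k) (i : Fin k) :
    A.curve i ⊆ A.plane := subset_iUnion _ i

theorem exists_isSectionFamily {φ : C' → {x : P2 // x ∈ A.plane}} (hφ : IsDoubleCover φ) :
    ∃ s, IsSectionFamily A φ s := by
  have key (i : Fin k) : ∃ t : Bool → A.curve i → C', (∀ ε, Continuous (t ε)) ∧
      (∀ ε x, (φ (t ε x) : P2) = x) ∧ ∀ x, t true x ≠ t false x := by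
    let ι : A.curve i → {x : P2 // x ∈ A.plane} := inclusion (A.curve_subset_plane i)
    have hι : Continuous ι := continuous_inclusion _
    have hch := A.hasTwoCharts i
    have := hch.preconnectedSpace
    obtain ⟨x₀⟩ := hch.nonempty
    have hcard := hφ.2 (ι x₀)
    rw [Nat.card_coe_set_eq, Set.ncard_eq_two] at hcard
    obtain ⟨u, v, huv, hfib⟩ := hcard
    have hu : φ u = ι x₀ := by
      have : u ∈ φ ⁻¹' {ι x₀} := hfib ▸ mem_insert u {v}
      exact this
    have hv : φ v = ι x₀ := by
      have : v ∈ φ ⁻¹' {ι x₀} := hfib ▸ mem_insert_of_mem u rfl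
      exact this
    obtain ⟨f, hfc, hf, hf0⟩ := hch.exists_lift hφ.1 hι hu
    obtain ⟨g, hgc, hg, hg0⟩ := hch.exists_lift hφ.1 hι hv
    refine ⟨fun ε => if ε then f else g, fun ε => ?_, fun ε x => ?_, fun x hx => ?_⟩
    · cases ε
      · exact hgc
      · exact hfc
    · cases ε
      · exact congrArg Subtype.val (congrFun hg x)
      · exact congrArg Subtype.val (congrFun hf x)
    · have := hφ.1.eq_of_comp_eq hfc hgc (hf.trans hg.symm) x hx
      apply huv
      rw [← hf0, ← hg0, this]
  choose s h1 h2 h3 using key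
  exact ⟨s, h1, h2, h3⟩

theorem exists_isGluingDataOf {φ : C' → {x : P2 // x ∈ A.plane}} (hφ : IsDoubleCover φ) :
    ∃ κ, IsGluingDataOf A φ κ := by
  obtain ⟨s, hs⟩ := exists_isSectionFamily hφ
  obtain ⟨κ, hκ⟩ := exists_glues s
  exact ⟨κ, (isGluingDataOf_iff hφ).2 ⟨s, hs, hκ⟩⟩

section Twist

variable {φ : C' → {x : P2 // x ∈ A.plane}} {s s' : ∀ i, Bool → A.curve i → C'} {κ κ' : GluingData A}

theorem IsSectionFamily.twist (hs : IsSectionFamily A φ s) (σ : Fin k → Bool) :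
    IsSectionFamily A φ (twist σ s) where
  continuous i ε := hs.continuous i _
  map_apply i ε x := hs.map_apply i _ x
  ne i x h := by simpa using hs.sheet_injective.1 h

theorem IsSectionFamily.glues_flipAt (hs : IsSectionFamily A φ s) (hφ : IsDoubleCover φ)
    (hκ : Glues s κ) (a : Fin k) :
    Glues (_root_.twist (fun i => decide (i = a)) s) (flipAt A a κ) := by
  intro Q i j hij hi hj
  have h1 : (Q : P2) ∈ A.curve a ↔ (a = i ∨ a = j) := by
    refine ⟨(A.nodes i j hij Q ⟨hi, hj⟩).1 a, ?_⟩
    rintro (rfl | rfl)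
    · exact hi
    · exact hj
  rw [_root_.twist, _root_.twist, hs.glue_iff hφ hκ Q hij]
  unfold flipAt
  by_cases hai : a = i
  · subst hai
    simp [hi, hij.symm]
  · by_cases haj : a = j
    · subst haj
      simp [hj, hij]
    · have : (Q : P2) ∉ A.curve a := by simp [h1, hai, haj]
      simp [this, Ne.symm hai, Ne.symm haj]

theorem IsSectionFamily.gluingEquiv_of_twist (hφ : IsDoubleCover φ) (T : Finset (Fin k)) :
    ∀ (s : ∀ i, Bool → A.curve i → C') (κ κ' : GluingData A) (σ : Fin k → Bool),
      IsSectionFamily A φ s → Glues s κ → Glues (_root_.twist σ s) κ' →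
      (∀ i ∉ T, σ i = false) → GluingEquiv A κ κ' := by
  induction T using Finset.induction_on with
  | empty =>
    intro s κ κ' σ hs hκ hκ' hσ
    have : _root_.twist σ s = s := by
      funext i ε
      simp [_root_.twist, hσ i (by simp)]
    rw [this] at hκ'
    rw [hκ.unique hκ']
    exact Relation.ReflTransGen.refl
  | insert a T ha ih =>
    intro s κ κ' σ hs hκ hκ' hσ
    cases hσa : σ a with
    | false =>
      refine ih s κ κ' σ hs hκ hκ' fun i hi => ?_
      by_cases hia : i = a
      · rw [hia, hσa]
      · exact hσ i (by simp [hia, hi])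
    | true =>
      refine Relation.ReflTransGen.head ⟨a, rfl⟩ (ih _ _ _
        (fun i => xor (σ i) (decide (i = a))) (hs.twist _) (hs.glues_flipAt hφ hκ a) ?_
        fun i hi => ?_)
      · rw [twist_twist]
        convert! hκ' using 2
        funext i
        simp
      · by_cases hia : i = a
        · simp [hia, hσa]
        · simp [hia, hσ i (by simp [hia, hi])]

theorem IsSectionFamily.exists_eq_twist (hφ : IsDoubleCover φ) (hs : IsSectionFamily A φ s)
    (hs' : IsSectionFamily A φ s') : ∃ σ, s' = _root_.twist σ s := by
  have key (i : Fin k) : ∃ b : Bool, ∀ ε, s' i ε = s i (xor ε b) := by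
    have hch := A.hasTwoCharts i
    have := hch.preconnectedSpace
    obtain ⟨x₀⟩ := hch.nonempty
    obtain ⟨ε, hε⟩ := hs.exists_eq' hφ (y := s' i true x₀) x₀ (hs'.map_apply _ _ _)
    have h1 : s' i true = s i ε := by
      refine hφ.1.eq_of_comp_eq (hs'.continuous i _) (hs.continuous i _) ?_ x₀ hε
      funext x
      exact Subtype.ext ((hs'.map_apply i _ x).trans (hs.map_apply i _ x).symm)
    have h2 : s' i false = s i (!ε) := by
      funext x
      obtain ⟨δ, hδ⟩ := hs.exists_eq' hφ (y := s' i false x) x (hs'.map_apply _ _ _)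
      have hne := hs'.ne i x
      rw [h1, hδ, Ne, hs.sheet_injective] at hne
      rw [hδ]
      congr 1
      cases ε <;> cases δ <;> simp_all
    refine ⟨!ε, fun δ => ?_⟩
    cases δ
    · simpa using h2
    · simpa using h1
  choose σ hσ using key
  exact ⟨σ, funext fun i => funext fun ε => hσ i ε⟩

end Twist

theorem IsGluingDataOf.gluingEquiv {φ : C' → {x : P2 // x ∈ A.plane}} (hφ : IsDoubleCover φ)
    {κ κ' : GluingData A} (h : IsGluingDataOf A φ κ) (h' : IsGluingDataOf A φ κ') :
    GluingEquiv A κ κ' := by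
  rw [isGluingDataOf_iff hφ] at h h'
  obtain ⟨s, hs, hκ⟩ := h
  obtain ⟨s', hs', hκ'⟩ := h'
  obtain ⟨σ, rfl⟩ := hs.exists_eq_twist hφ hs'
  exact IsSectionFamily.gluingEquiv_of_twist hφ Finset.univ s κ κ' σ hs hκ hκ' (by simp)

theorem IsGluingDataOf.of_gluingEquiv {φ : C' → {x : P2 // x ∈ A.plane}} (hφ : IsDoubleCover φ)
    {κ κ' : GluingData A} (h : IsGluingDataOf A φ κ) (hκ : GluingEquiv A κ κ') :
    IsGluingDataOf A φ κ' := by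
  induction hκ with
  | refl => exact h
  | tail _ hstep ih =>
    obtain ⟨a, rfl⟩ := hstep
    rw [isGluingDataOf_iff hφ] at ih ⊢
    obtain ⟨s, hs, hκ⟩ := ih
    exact ⟨_, hs.twist _, hs.glues_flipAt hφ hκ a⟩

theorem gluingEquiv_equivalence (A : ConicLineArrangement k) : Equivalence (GluingEquiv A) where
  refl _ := Relation.ReflTransGen.refl
  symm h := by
    induction h with
    | refl => exact Relation.ReflTransGen.refl
    | tail _ hstep ih =>
      obtain ⟨a, rfl⟩ := hstep
      refine Relation.ReflTransGen.head ⟨a, funext fun Q => ?_⟩ ih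
      by_cases hQ : (Q : P2) ∈ A.curve a <;> simp [flipAt, hQ]
  trans := Relation.ReflTransGen.trans

end Sections

section Transport

open Set Topology

variable {k : ℕ} {A : ConicLineArrangement k} {C' C'' : Type} [TopologicalSpace C']
  [TopologicalSpace C''] {φ : C' → {x : P2 // x ∈ A.plane}} {ψ : C'' → {x : P2 // x ∈ A.plane}}
  {s : ∀ i, Bool → A.curve i → C'} {t : ∀ i, Bool → A.curve i → C''} {κ : GluingData A}

namespace IsSectionFamily

theorem exists_apply_eq (hs : IsSectionFamily A φ s) (hφ : IsDoubleCover φ) (y : C') :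
    ∃ i ε x, s i ε x = y := by
  obtain ⟨i, hi⟩ := mem_iUnion.1 (φ y).2
  obtain ⟨ε, hε⟩ := hs.exists_eq hφ hi
  exact ⟨i, ε, _, hε.symm⟩

theorem eq_imp_eq (hs : IsSectionFamily A φ s) (hφ : IsDoubleCover φ)
    (ht : IsSectionFamily A ψ t) (hψ : IsDoubleCover ψ) (hsκ : Glues s κ) (htκ : Glues t κ)
    {i j : Fin k} {ε δ : Bool} {x : A.curve i} {x' : A.curve j} (h : s i ε x = s j δ x') :
    t i ε x = t j δ x' := by
  obtain ⟨x, hi⟩ := x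
  obtain ⟨x', hj⟩ := x'
  obtain rfl : x = x' := by
    have h1 := hs.map_apply i ε ⟨x, hi⟩
    rw [h, hs.map_apply] at h1
    exact h1.symm
  by_cases hij : i = j
  · subst hij
    rw [hs.sheet_injective] at h
    rw [h]
  · have hQ : x ∈ A.sing := ⟨i, j, hij, hi, hj⟩
    rw [hs.glue_iff hφ hsκ ⟨x, hQ⟩ hij hi hj] at h
    exact (ht.glue_iff hψ htκ ⟨x, hQ⟩ hij hi hj ε δ).2 h

theorem isClosed_range (hs : IsSectionFamily A φ s) (hφ : IsDoubleCover φ) (i : Fin k) (ε : Bool) :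
    IsClosed (range (s i ε)) := by
  have hφc : Continuous fun y : C' => (φ y : P2) :=
    continuous_subtype_val.comp hφ.1.continuous
  have hcl : IsClosed {y : C' | (φ y : P2) ∈ A.curve i} := (A.isClosed_curve i).preimage hφc
  have heq : IsClosed {y : {y : C' | (φ y : P2) ∈ A.curve i} |
      s i ε ⟨φ y, y.2⟩ = (y : C')} :=
    hφ.1.isSeparatedMap.isClosed_eqLocus
      ((hs.continuous i ε).comp ((hφc.comp continuous_subtype_val).subtype_mk _))
      continuous_subtype_val (funext fun y => hs.map_eq y.2 ε)
  convert! hcl.isClosedMap_subtype_val _ heq using 1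
  ext y
  constructor
  · rintro ⟨x, rfl⟩
    have hx : (φ (s i ε x) : P2) = x := hs.map_apply i ε x
    refine ⟨⟨s i ε x, by rw [mem_ofPred_eq, hx]; exact x.2⟩, ?_, rfl⟩
    exact congrArg (s i ε) (Subtype.ext hx)
  · rintro ⟨y, hy, rfl⟩
    exact ⟨_, hy⟩

theorem exists_continuous_map (hs : IsSectionFamily A φ s) (hφ : IsDoubleCover φ)
    (ht : IsSectionFamily A ψ t) (hψ : IsDoubleCover ψ) (hsκ : Glues s κ) (htκ : Glues t κ) :
    ∃ h : C' → C'', Continuous h ∧ ∀ i ε x, h (s i ε x) = t i ε x := by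
  choose I E X hX using hs.exists_apply_eq hφ
  have key (i ε x) : t (I (s i ε x)) (E (s i ε x)) (X (s i ε x)) = t i ε x :=
    hs.eq_imp_eq hφ ht hψ hsκ htκ (hX _)
  refine ⟨fun y => t (I y) (E y) (X y), ?_, key⟩
  have hφc : Continuous fun y : C' => (φ y : P2) :=
    continuous_subtype_val.comp hφ.1.continuous
  refine (locallyFinite_of_finite fun p : Fin k × Bool => range (s p.1 p.2)).continuous
    (eq_univ_of_forall fun y => ?_) (fun p => hs.isClosed_range hφ p.1 p.2) fun p => ?_
  · obtain ⟨i, ε, x, hx⟩ := hs.exists_apply_eq hφ y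
    exact mem_iUnion.2 ⟨(i, ε), x, hx⟩
  · obtain ⟨i, ε⟩ := p
    rw [continuousOn_iff_continuous_domRestrict]
    have hmem (y : range (s i ε)) : (φ y : P2) ∈ A.curve i := by
      obtain ⟨_, x, rfl⟩ := y
      rw [hs.map_apply]; exact x.2
    have hc : Continuous fun y : range (s i ε) => t i ε ⟨φ y, hmem y⟩ :=
      (ht.continuous i ε).comp ((hφc.comp continuous_subtype_val).subtype_mk _)
    convert! hc using 1
    funext y
    obtain ⟨_, x, rfl⟩ := y
    change t _ _ _ = _
    rw [key]
    exact congrArg (t i ε) (Subtype.ext (hs.map_apply i ε x).symm)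

theorem exists_homeomorph (hs : IsSectionFamily A φ s) (hφ : IsDoubleCover φ)
    (ht : IsSectionFamily A ψ t) (hψ : IsDoubleCover ψ) (hsκ : Glues s κ) (htκ : Glues t κ) :
    ∃ h : C' ≃ₜ C'', ∀ y, ψ (h y) = φ y := by
  obtain ⟨f, hfc, hf⟩ := hs.exists_continuous_map hφ ht hψ hsκ htκ
  obtain ⟨g, hgc, hg⟩ := ht.exists_continuous_map hψ hs hφ htκ hsκ
  refine ⟨⟨⟨f, g, fun y => ?_, fun y => ?_⟩, hfc, hgc⟩, fun y => ?_⟩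
  · obtain ⟨i, ε, x, rfl⟩ := hs.exists_apply_eq hφ y
    rw [hf, hg]
  · obtain ⟨i, ε, x, rfl⟩ := ht.exists_apply_eq hψ y
    rw [hg, hf]
  · obtain ⟨i, ε, x, rfl⟩ := hs.exists_apply_eq hφ y
    refine Subtype.ext ?_
    change (ψ (f _) : P2) = _
    rw [hf, ht.map_apply, hs.map_apply]

end IsSectionFamily

theorem HomeoOver.isGluingDataOf {D D' : DoubleCoverOf A} (h : HomeoOver D D')
    (hκ : IsGluingDataOf A D.map κ) : IsGluingDataOf A D'.map κ := by
  rw [isGluingDataOf_iff D.is_cover] at hκ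
  rw [isGluingDataOf_iff D'.is_cover]
  obtain ⟨s, hs, hsκ⟩ := hκ
  obtain ⟨h, hh⟩ := h
  refine ⟨fun i ε x => h (s i ε x), ⟨fun i ε => h.continuous.comp (hs.continuous i ε),
    fun i ε x => ?_, fun i x hx => hs.ne i x (h.injective hx)⟩, fun Q i j hij hi hj => ?_⟩
  · rw [hh, hs.map_apply]
  · rw [hsκ Q i j hij hi hj, h.injective.eq_iff]

theorem homeoOver_iff (D D' : DoubleCoverOf A) :
    HomeoOver D D' ↔ ∃ κ κ' : GluingData A, IsGluingDataOf A D.map κ ∧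
      IsGluingDataOf A D'.map κ' ∧ GluingEquiv A κ κ' := by
  constructor
  · intro h
    obtain ⟨κ, hκ⟩ := exists_isGluingDataOf D.is_cover
    exact ⟨κ, κ, hκ, h.isGluingDataOf hκ, Relation.ReflTransGen.refl⟩
  · rintro ⟨κ, κ', hκ, hκ', hequiv⟩
    have h := hκ.of_gluingEquiv D.is_cover hequiv
    rw [isGluingDataOf_iff D.is_cover] at h
    rw [isGluingDataOf_iff D'.is_cover] at hκ'
    obtain ⟨s, hs, hsκ⟩ := h
    obtain ⟨t, ht, htκ⟩ := hκ'
    exact hs.exists_homeomorph D.is_cover ht D'.is_cover hsκ htκ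

end Transport

section Realization

open Set Topology Bundle

variable {k : ℕ} (A : ConicLineArrangement k)

/-- A component through a given point of the arrangement. -/
def componentAt (x : {x : P2 // x ∈ A.plane}) : Fin k := (mem_iUnion.1 x.2).choose

theorem mem_curve_componentAt (x : {x : P2 // x ∈ A.plane}) :
    (x : P2) ∈ A.curve (componentAt A x) := (mem_iUnion.1 x.2).choose_spec

variable {A}

theorem componentAt_eq {x : {x : P2 // x ∈ A.plane}} {i : Fin k} (hi : (x : P2) ∈ A.curve i)
    (hx : (x : P2) ∉ A.sing) : componentAt A x = i := by
  by_contra h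
  exact hx ⟨_, i, h, mem_curve_componentAt A x, hi⟩

open Classical in
/-- The labels, in a chart of the double cover around `x`, of the `+`-sheets over the
components. -/
def frame (κ : GluingData A) (x : {x : P2 // x ∈ A.plane}) (i : Fin k) : Bool :=
  if h : (x : P2) ∈ A.sing then (decide (i ≠ componentAt A x) && !κ ⟨x, h⟩) else false

theorem frame_eq_frame_iff (κ : GluingData A) {x : {x : P2 // x ∈ A.plane}} {i j : Fin k}
    (hij : i ≠ j) (hi : (x : P2) ∈ A.curve i) (hj : (x : P2) ∈ A.curve j) :
    frame κ x i = frame κ x j ↔ κ ⟨x, i, j, hij, hi, hj⟩ = true := by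
  have hx : (x : P2) ∈ A.sing := ⟨i, j, hij, hi, hj⟩
  rcases (A.nodes i j hij x ⟨hi, hj⟩).1 _ (mem_curve_componentAt A x) with h | h
  · simp [frame, hx, h, hij.symm]
  · simp [frame, hx, h, hij]

theorem continuousOn_frame_componentAt (κ : GluingData A) (x₀ x₁ : {x : P2 // x ∈ A.plane}) :
    ContinuousOn (fun x => xor (frame κ x₀ (componentAt A x)) (frame κ x₁ (componentAt A x)))
      ({x | (x : P2) ∈ A.sing → x = x₀} ∩ {x | (x : P2) ∈ A.sing → x = x₁}) := by
  rintro x ⟨h0, h1⟩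
  by_cases h01 : x₀ = x₁
  · subst h01
    simp only [Bool.xor_self]
    exact continuousWithinAt_const
  have hx : (x : P2) ∉ A.sing := fun h => h01 ((h0 h).symm.trans (h1 h))
  have hcl : IsClosed (⋃ i : {i // i ≠ componentAt A x},
      {y : {x : P2 // x ∈ A.plane} | (y : P2) ∈ A.curve i}) :=
    isClosed_iUnion_of_finite fun i => (A.isClosed_curve i).preimage continuous_subtype_val
  have hmem : (⋃ i : {i // i ≠ componentAt A x},
      {y : {x : P2 // x ∈ A.plane} | (y : P2) ∈ A.curve i})ᶜ ∈ 𝓝 x := by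
    refine hcl.isOpen_compl.mem_nhds fun h => ?_
    obtain ⟨⟨i, hi⟩, h⟩ := mem_iUnion.1 h
    exact hi (componentAt_eq h hx).symm
  refine ContinuousAt.continuousWithinAt ?_
  refine (continuousAt_const (y := xor (frame κ x₀ (componentAt A x))
    (frame κ x₁ (componentAt A x)))).congr ?_
  filter_upwards [hmem] with y hy
  have : componentAt A y = componentAt A x := by
    by_contra h
    exact hy (mem_iUnion.2 ⟨⟨_, h⟩, mem_curve_componentAt A y⟩)
  rw [this]

/-- The double cover with prescribed gluing data, described by charts around the points of the
arrangement whose transition functions compare the corresponding frames. -/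
def coverCore (κ : GluingData A) :
    FiberBundleCore {x : P2 // x ∈ A.plane} {x : P2 // x ∈ A.plane} Bool where
  baseSet x₀ := {x | (x : P2) ∈ A.sing → x = x₀}
  isOpen_baseSet x₀ := by
    have hfin : {x : {x : P2 // x ∈ A.plane} | (x : P2) ∈ A.sing ∧ x ≠ x₀}.Finite :=
      (A.finite_sing.preimage Subtype.val_injective.injOn).subset fun x hx => hx.1
    convert! hfin.isClosed.isOpen_compl using 1
    ext x
    simp
  indexAt x := x
  mem_baseSet_at _ _ := rfl
  coordChange x₀ x₁ x b :=
    xor b (xor (frame κ x₀ (componentAt A x)) (frame κ x₁ (componentAt A x)))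
  coordChange_self _ _ _ _ := by simp
  continuousOn_coordChange x₀ x₁ :=
    (continuous_of_discreteTopology (f := fun b : Bool × Bool => xor b.1 b.2)).comp_continuousOn
      (continuousOn_snd.prodMk ((continuousOn_frame_componentAt κ x₀ x₁).comp continuousOn_fst
        fun p hp => hp.1))
  coordChange_comp x₀ x₁ x₂ x _ b := by
    cases b <;> cases frame κ x₀ (componentAt A x) <;> cases frame κ x₁ (componentAt A x) <;> simp

theorem isDoubleCover_coverCore (κ : GluingData A) : IsDoubleCover (coverCore κ).proj := by
  refine ⟨FiberBundle.isCoveringMap (F := Bool) (E := (coverCore κ).Fiber), fun x => ?_⟩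
  let e : Bool ≃ (coverCore κ).proj ⁻¹' {x} :=
    Equiv.ofBijective (fun b => ⟨⟨x, b⟩, rfl⟩) ⟨fun b c h => by
      have := congrArg Subtype.val h
      exact eq_of_heq (TotalSpace.mk.inj this).2, by
      rintro ⟨⟨y, b⟩, rfl⟩
      exact ⟨b, rfl⟩⟩
  rw [← Nat.card_congr e, Nat.card_eq_fintype_card, Fintype.card_bool]

/-- The sections over the components of the double cover with prescribed gluing data. -/
def coverSection (κ : GluingData A) (i : Fin k) (ε : Bool) (x : A.curve i) :
    (coverCore κ).TotalSpace :=
  ⟨inclusion (A.curve_subset_plane i) x, xor ε (frame κ (inclusion (A.curve_subset_plane i) x) i)⟩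

theorem continuous_coverSection (κ : GluingData A) (i : Fin k) (ε : Bool) :
    Continuous (coverSection κ i ε) := by
  rw [continuous_iff_continuousAt]
  intro x₀
  rw [FiberBundle.continuousAt_totalSpace]
  refine ⟨(continuous_inclusion (A.curve_subset_plane i)).continuousAt, ?_⟩
  set ι := inclusion (A.curve_subset_plane i) with hι
  refine (continuousAt_const (y := xor ε (frame κ (ι x₀) i))).congr ?_
  have hopen := ((coverCore κ).isOpen_baseSet (ι x₀)).preimage
    (continuous_inclusion (A.curve_subset_plane i))
  filter_upwards [hopen.mem_nhds (x := x₀) fun _ => rfl] with x hx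
  change _ = xor (xor ε (frame κ (ι x) i))
    (xor (frame κ (ι x) (componentAt A (ι x))) (frame κ (ι x₀) (componentAt A (ι x))))
  by_cases hsing : (x : P2) ∈ A.sing
  · rw [show ι x = ι x₀ from hx hsing]
    simp
  · rw [componentAt_eq (x := ι x) x.2 hsing]
    cases ε <;> simp

theorem exists_doubleCoverOf (κ : GluingData A) :
    ∃ D : DoubleCoverOf A, IsGluingDataOf A D.map κ := by
  refine ⟨⟨(coverCore κ).TotalSpace, inferInstance, (coverCore κ).proj,
    isDoubleCover_coverCore κ⟩, ?_⟩
  rw [isGluingDataOf_iff (isDoubleCover_coverCore κ)]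
  have hinj {x : {x : P2 // x ∈ A.plane}} {a b : Bool} :
      (⟨x, a⟩ : (coverCore κ).TotalSpace) = ⟨x, b⟩ ↔ a = b :=
    ⟨fun h => eq_of_heq (TotalSpace.mk.inj h).2, fun h => by rw [h]⟩
  refine ⟨coverSection κ, ⟨continuous_coverSection κ, fun _ _ _ => rfl, fun i x h => ?_⟩,
    fun Q i j hij hi hj => ?_⟩
  · simpa using hinj.1 h
  · refine (frame_eq_frame_iff κ (x := ⟨Q, A.curve_subset_plane i hi⟩) hij hi hj).symm.trans ?_
    refine Iff.trans ?_ hinj.symm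
    exact ⟨fun h => by rw [h], fun h => by simpa using h⟩

end Realization

section Statement3

/-- Let `C = C₁ + ⋯ + C_k` be a conic-line arrangement with simple nodes.
Two topological double covers of `C` are homeomorphic over `C` if and only if their gluing
data are equivalent.  Consequently the map `Ψ` from the set of homeomorphism classes over
`C` of topological double covers of `C` to the set of equivalence classes of gluing data on
`C`, given by `[φ] ↦ [κ_φ]`, is a bijection. -/
theorem statement3 {k : ℕ} (A : ConicLineArrangement k) :
    (∀ D D' : DoubleCoverOf A,
      HomeoOver D D' ↔
        ∃ κ κ' : GluingData A, IsGluingDataOf A D.map κ ∧ IsGluingDataOf A D'.map κ' ∧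
          GluingEquiv A κ κ') ∧
    (∃ Ψ : Quot (HomeoOver (A := A)) ≃ Quot (GluingEquiv A),
      ∀ (D : DoubleCoverOf A) (κ : GluingData A),
        IsGluingDataOf A D.map κ → Ψ (Quot.mk _ D) = Quot.mk _ κ) := by
  refine ⟨homeoOver_iff, ?_⟩
  choose g hg using fun D : DoubleCoverOf A => exists_isGluingDataOf D.is_cover
  let Ψ : Quot (HomeoOver (A := A)) → Quot (GluingEquiv A) :=
    Quot.lift (fun D => Quot.mk _ (g D)) fun D D' h =>
      Quot.sound ((h.isGluingDataOf (hg D)).gluingEquiv D'.is_cover (hg D'))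
  have hΨ (D : DoubleCoverOf A) (κ : GluingData A) (hκ : IsGluingDataOf A D.map κ) :
      Ψ (Quot.mk _ D) = Quot.mk _ κ := Quot.sound ((hg D).gluingEquiv D.is_cover hκ)
  refine ⟨Equiv.ofBijective Ψ ⟨?_, ?_⟩, hΨ⟩
  · rintro ⟨D⟩ ⟨D'⟩ h
    have h' := (gluingEquiv_equivalence A).eqvGen_iff.1 (Quot.eqvGen_exact h)
    exact Quot.sound ((homeoOver_iff D D').2 ⟨_, _, hg D, hg D', h'⟩)
  · rintro ⟨κ⟩
    obtain ⟨D, hD⟩ := exists_doubleCoverOf κ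
    exact ⟨Quot.mk _ D, hΨ D κ hD⟩

end Statement3

end
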